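/- arXiv:2003.09502 — 4 statements merged into one kernel-verified Lean document; each statement's English description precedes it below -/
import Mathlib

section
/- Let G be a finite group and ρ a finite-dimensional complex representation of G with character χ_ρ. The McKay matrix A_ρ(G) is symmetric (i.e., ⟨χ_ρ · χ_i, χ_j⟩ = ⟨χ_ρ · χ_j, χ_i⟩ for all irreducible characters χ_i, χ_j of G) if and only if ρ is self-dual, i.e., χ_ρ(g) = conj(χ_ρ(g)) for all g ∈ G. -/
/-- A function `χ : G → ℂ` is an irreducible character of `G` if it is the character of
some simple (irreducible) finite-dimensional complex representation of `G`. -/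
def IsIrrChar (G : Type) [Group G] (χ : G → ℂ) : Prop :=
  ∃ V : FDRep ℂ G, CategoryTheory.Simple V ∧ V.character = χ

/-- The standard inner product of complex-valued class functions on a finite group. -/
noncomputable def innChar (G : Type) [Group G] [Fintype G] (φ ψ : G → ℂ) : ℂ :=
  (Fintype.card G : ℂ)⁻¹ * ∑ g : G, φ g * (starRingEnd ℂ) (ψ g)

open Module ComplexOrder in
/-- The character of a complex representation of a finite group satisfies
`χ(g⁻¹) = conj (χ(g))`. -/
theorem Representation.character_inv_eq_conj {G V : Type*} [Group G] [Fintype G]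
    [AddCommGroup V] [Module ℂ V] [FiniteDimensional ℂ V] (ρ : Representation ℂ G V) (g : G) :
    ρ.character g⁻¹ = (starRingEnd ℂ) (ρ.character g) := by
  classical
  let b := finBasis ℂ V
  let R : G → Matrix _ _ ℂ := fun h => LinearMap.toMatrix b b (ρ h)
  have hR (x y : G) : R (x * y) = R x * R y := by
    simp only [R, map_mul, LinearMap.toMatrix_mul]
  have hR1 : R 1 = 1 := by simp only [R, map_one, LinearMap.toMatrix_one]
  have hχ (x : G) : ρ.character x = (R x).trace :=
    LinearMap.trace_eq_matrix_trace ℂ b (ρ x)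
  let M := ∑ h : G, (R h).conjTranspose * R h
  have hM : M.PosDef := by
    have : M = 1 + ∑ h ∈ Finset.univ.erase (1 : G), (R h).conjTranspose * R h := by
      simp only [M]
      rw [← Finset.add_sum_erase _ _ (Finset.mem_univ (1 : G)), hR1]
      simp
    rw [this]
    exact Matrix.PosDef.one.add_posSemidef
      (Matrix.posSemidef_sum _ fun h _ => Matrix.posSemidef_conjTranspose_mul_self (R h))
  have hinv : (R g).conjTranspose * M * R g = M := by
    simp only [M, Finset.mul_sum, Finset.sum_mul]
    refine Fintype.sum_equiv (Equiv.mulRight g) _ _ fun h => ?_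
    simp only [Equiv.coe_mulRight, hR, Matrix.conjTranspose_mul, Matrix.mul_assoc]
  have hgg : R g * R g⁻¹ = 1 := by rw [← hR, mul_inv_cancel, hR1]
  have hdet : IsUnit M.det := (Matrix.isUnit_iff_isUnit_det M).mp hM.isUnit
  have hconj : (R g).conjTranspose = M * R g⁻¹ * M⁻¹ := by
    calc (R g).conjTranspose
        = (R g).conjTranspose * M * (R g * R g⁻¹) * M⁻¹ := by
          rw [hgg, Matrix.mul_one, Matrix.mul_nonsing_inv_cancel_right _ _ hdet]
      _ = (R g).conjTranspose * M * R g * R g⁻¹ * M⁻¹ := by simp only [Matrix.mul_assoc]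
      _ = M * R g⁻¹ * M⁻¹ := by rw [hinv]
  rw [hχ, hχ, starRingEnd_apply, ← Matrix.trace_conjTranspose, hconj, Matrix.trace_mul_cycle,
    Matrix.nonsing_inv_mul _ hdet, Matrix.one_mul]

/-- The character is additive along a decomposition into complementary subrepresentations. -/
theorem Representation.character_eq_add_of_isCompl {G k V : Type*} [Monoid G] [Field k]
    [AddCommGroup V] [Module k V] [FiniteDimensional k V] {ρ : Representation k G V}
    {σ τ : Subrepresentation ρ} (h : IsCompl σ.toSubmodule τ.toSubmodule) :
    ρ.character = σ.toRepresentation.character + τ.toRepresentation.character := by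
  ext g
  simp only [character, Pi.add_apply]
  rw [← LinearMap.trace_prodMap', ← LinearMap.trace_conj' _ (Submodule.prodEquivOfIsCompl _ _ h)]
  congr 1
  ext v
  obtain ⟨w, rfl⟩ := (Submodule.prodEquivOfIsCompl _ _ h).surjective v
  simp [LinearEquiv.conj_apply, Subrepresentation.toRepresentation]

/-- The `FDRep` attached to an irreducible complex representation of a finite group is simple. -/
theorem FDRep.simple_of_isIrreducible {G : Type} [Group G] [Fintype G] {V : Type}
    [AddCommGroup V] [Module ℂ V] [FiniteDimensional ℂ V] (ρ : Representation ℂ G V)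
    [ρ.IsIrreducible] : CategoryTheory.Simple (FDRep.of ρ) := by
  have hG : (Nat.card G : ℂ) ≠ 0 := NeZero.ne _
  let : Invertible (Nat.card G : ℂ) := invertibleOfNonzero hG
  rw [FDRep.simple_iff_char_is_norm_one]
  have h := Representation.char_orthonormal ρ ρ
  rw [if_pos ⟨.refl ρ⟩, inv_mul_eq_one₀ hG] at h
  exact h.symm

/-- Every character of a finite group is a sum of irreducible characters. -/
theorem Representation.character_mem_closure_isIrrChar {G : Type} [Group G] [Fintype G]
    {V : Type} [AddCommGroup V] [Module ℂ V] [FiniteDimensional ℂ V]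
    (ρ : Representation ℂ G V) :
    ρ.character ∈ AddSubmonoid.closure {χ | IsIrrChar G χ} := by
  induction hn : Module.finrank ℂ V using Nat.strong_induction_on generalizing V with
  | _ n ih =>
  subst hn
  by_cases hirr : ρ.IsIrreducible
  · exact AddSubmonoid.subset_closure ⟨FDRep.of ρ, FDRep.simple_of_isIrreducible ρ, rfl⟩
  rcases subsingleton_or_nontrivial V with hV | hV
  · have : ρ.character = 0 := by
      ext g
      simp [character, Subsingleton.elim (ρ g) 0]
    rw [this]
    exact zero_mem _
  obtain ⟨σ, hbot, htop⟩ : ∃ σ : Subrepresentation ρ, σ ≠ ⊥ ∧ σ ≠ ⊤ := by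
    by_contra! h
    have : Nontrivial (Subrepresentation ρ) :=
      ⟨⊥, ⊤, fun h' => bot_ne_top (α := Submodule ℂ V)
        (congrArg Subrepresentation.toSubmodule h')⟩
    exact hirr ⟨fun σ => or_iff_not_imp_left.mpr (h σ)⟩
  obtain ⟨τ, hτ⟩ := exists_isCompl σ
  have hc : IsCompl σ.toSubmodule τ.toSubmodule :=
    ⟨disjoint_iff.mpr (congrArg Subrepresentation.toSubmodule hτ.inf_eq_bot),
      codisjoint_iff.mpr (congrArg Subrepresentation.toSubmodule hτ.sup_eq_top)⟩
  have hlt (κ : Subrepresentation ρ) (hκ : κ ≠ ⊤) :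
      Module.finrank ℂ κ.toSubmodule < Module.finrank ℂ V :=
    Submodule.finrank_lt fun h => hκ (Subrepresentation.toSubmodule_injective h)
  have hτtop : τ ≠ ⊤ := fun h => hbot (by simpa [h] using hτ.inf_eq_bot)
  rw [character_eq_add_of_isCompl hc]
  exact add_mem (ih _ (hlt σ htop) _ rfl) (ih _ (hlt τ hτtop) _ rfl)

theorem FDRep.character_inv_eq_conj {G : Type} [Group G] [Fintype G] (V : FDRep ℂ G) (g : G) :
    V.character g⁻¹ = (starRingEnd ℂ) (V.character g) :=
  Representation.character_inv_eq_conj V.ρ g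

/-- The constant function `1` is an irreducible character. -/
theorem isIrrChar_one (G : Type) [Group G] [Fintype G] : IsIrrChar G 1 := by
  have h : (FDRep.of (Representation.trivial ℂ G ℂ)).character = 1 := by
    ext g
    simp [FDRep.character]
  refine ⟨_, ?_, h⟩
  rw [FDRep.simple_iff_char_is_norm_one, h]
  simp

/-- A class function orthogonal to all irreducible characters is orthogonal to all characters. -/
theorem innChar_character_eq_zero {G : Type} [Group G] [Fintype G] {φ : G → ℂ}
    (h : ∀ χ, IsIrrChar G χ → innChar G φ χ = 0) {V : Type} [AddCommGroup V] [Module ℂ V]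
    [FiniteDimensional ℂ V] (ρ : Representation ℂ G V) : innChar G φ ρ.character = 0 := by
  have hρ := ρ.character_mem_closure_isIrrChar
  generalize ρ.character = θ at hρ ⊢
  induction hρ using AddSubmonoid.closure_induction with
  | mem χ hχ => exact h χ hχ
  | zero => simp [innChar]
  | add χ ψ _ _ hχ hψ =>
    have : innChar G φ (χ + ψ) = innChar G φ χ + innChar G φ ψ := by
      simp [innChar, mul_add, Finset.sum_add_distrib]
    rw [this, hχ, hψ, add_zero]

theorem eq_zero_of_innChar_self_eq_zero {G : Type} [Group G] [Fintype G] {φ : G → ℂ}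
    (h : innChar G φ φ = 0) : φ = 0 := by
  simp only [innChar, Complex.mul_conj, mul_eq_zero, inv_eq_zero, Nat.cast_eq_zero,
    Fintype.card_ne_zero, false_or] at h
  norm_cast at h
  rw [Finset.sum_eq_zero_iff_of_nonneg fun g _ => Complex.normSq_nonneg _] at h
  ext g
  exact Complex.normSq_eq_zero.mp (h g (Finset.mem_univ g))

/-- The McKay matrix `A_ρ(G)` is symmetric if and only if `ρ` is self-dual, i.e. its
character is real-valued: `χ_ρ(g) = conj (χ_ρ(g))` for all `g ∈ G`. -/
theorem mckay_matrix_symmetric_iff_self_dual (G : Type) [Group G] [Fintype G]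
    (Irr : Finset (G → ℂ)) (hIrr : ∀ χ, χ ∈ Irr ↔ IsIrrChar G χ)
    (ρ : FDRep ℂ G) :
    (∀ χi ∈ Irr, ∀ χj ∈ Irr,
        innChar G (ρ.character * χi) χj = innChar G (ρ.character * χj) χi) ↔
      (∀ g : G, ρ.character g = (starRingEnd ℂ) (ρ.character g)) := by
  constructor
  · intro hsymm
    let δ : G → ℂ := ρ.character - (Representation.dual ρ.ρ).character
    have hδ : ∀ χ, IsIrrChar G χ → innChar G δ χ = 0 := by
      rintro χ hχ
      have h := hsymm 1 ((hIrr _).mpr (isIrrChar_one G)) χ ((hIrr _).mpr hχ)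
      obtain ⟨V, -, rfl⟩ := hχ
      have hdual : innChar G (ρ.character * V.character) 1 =
          innChar G (Representation.dual ρ.ρ).character V.character := by
        simp only [innChar]
        congr 1
        refine Fintype.sum_equiv (Equiv.inv G) _ _ fun g => ?_
        rw [Equiv.inv_apply, Representation.char_dual, inv_inv, FDRep.character_inv_eq_conj]
        simp [FDRep.character, Representation.character]
      rw [mul_one, hdual] at h
      have hsub : innChar G δ V.character =
          innChar G ρ.character V.character - innChar G (Representation.dual ρ.ρ).character V.character := by
        simp [innChar, δ, sub_mul, mul_sub]
      rw [hsub, h, sub_self]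
    have hδδ : innChar G δ δ = 0 := by
      have hsub : innChar G δ δ =
          innChar G δ (Representation.character ρ.ρ) - innChar G δ (Representation.dual ρ.ρ).character := by
        simp only [innChar, ← mul_sub, ← Finset.sum_sub_distrib, ← map_sub]
        rfl
      rw [hsub, innChar_character_eq_zero hδ, innChar_character_eq_zero hδ, sub_self]
    intro g
    have h := congrFun (eq_zero_of_innChar_self_eq_zero hδδ) g
    simp only [δ, Pi.sub_apply, Representation.char_dual, Pi.zero_apply, sub_eq_zero] at h
    rw [← FDRep.character_inv_eq_conj]
    exact h
  · intro hreal χi hi χj hj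
    obtain ⟨V, -, rfl⟩ := (hIrr _).mp hi
    obtain ⟨W, -, rfl⟩ := (hIrr _).mp hj
    simp only [innChar, Pi.mul_apply]
    congr 1
    refine Fintype.sum_equiv (Equiv.inv G) _ _ fun g => ?_
    simp only [Equiv.inv_apply, FDRep.character_inv_eq_conj, ← hreal, Complex.conj_conj]
    ring
end

section
/- Let G be a finite group and ρ : G → GL(V) a finite-dimensional complex representation of G. Suppose there exists a bilinear form B : V × V → ℂ that is G-invariant (B(ρ(g)v, ρ(g)w) = B(v, w) for all g ∈ G and v, w ∈ V), alternating (B(v, v) = 0 for all v ∈ V), and non-degenerate (if B(v, w) = 0 for all w then v = 0). Then every diagonal entry of the McKay matrix A_ρ(G) is even: for every irreducible character χ_i of G, the non-negative integer ⟨χ_ρ · χ_i, χ_i⟩ is divisible by 2. -/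
/-- The trace pairing of endomorphisms of a vector space. -/
noncomputable def LinearMap.endTraceForm (k W : Type*) [Field k] [AddCommGroup W] [Module k W] :
    LinearMap.BilinForm k (W →ₗ[k] W) :=
  (LinearMap.mul k (Module.End k W)).compr₂ (LinearMap.trace k W)

theorem LinearMap.endTraceForm_apply {k W : Type*} [Field k] [AddCommGroup W] [Module k W]
    (a b : W →ₗ[k] W) : endTraceForm k W a b = trace k W (a ∘ₗ b) := rfl

theorem LinearMap.endTraceForm_injective (k W : Type*) [Field k] [AddCommGroup W] [Module k W]
    [FiniteDimensional k W] : Function.Injective (endTraceForm k W) := by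
  rw [injective_iff_map_eq_zero]
  intro a ha
  ext w
  rw [zero_apply, ← Module.forall_dual_apply_eq_zero_iff k]
  intro φ
  have h := LinearMap.congr_fun ha (φ.smulRight w)
  have hc : a ∘ₗ φ.smulRight w = φ.smulRight (a w) := by
    ext
    simp
  rwa [endTraceForm_apply, hc, trace_smulRight, zero_apply] at h

open TensorProduct in
/-- The bilinear form on a tensor product induced by forms on the two factors, as a map to the
dual space. -/
noncomputable def LinearMap.BilinForm.tensorToDual {k V E : Type*} [Field k]
    [AddCommGroup V] [Module k V] [AddCommGroup E] [Module k E]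
    (B : LinearMap.BilinForm k V) (T : LinearMap.BilinForm k E) :
    LinearMap.BilinForm k (V ⊗[k] E) :=
  TensorProduct.dualDistrib k V E ∘ₗ TensorProduct.map B T

open TensorProduct in
theorem LinearMap.BilinForm.tensorToDual_tmul {k V E : Type*} [Field k]
    [AddCommGroup V] [Module k V] [AddCommGroup E] [Module k E]
    (B : LinearMap.BilinForm k V) (T : LinearMap.BilinForm k E) (v w : V) (a b : E) :
    B.tensorToDual T (v ⊗ₜ a) (w ⊗ₜ b) = B v w * T a b := by
  simp [tensorToDual]

theorem LinearMap.BilinForm.tensorToDual_injective {k V E : Type*} [Field k]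
    [AddCommGroup V] [Module k V] [FiniteDimensional k V]
    [AddCommGroup E] [Module k E] [FiniteDimensional k E]
    {B : LinearMap.BilinForm k V} {T : LinearMap.BilinForm k E}
    (hB : Function.Injective B) (hT : Function.Injective T) :
    Function.Injective (B.tensorToDual T) := by
  have hd : Function.Injective (TensorProduct.dualDistrib k V E) :=
    (TensorProduct.dualDistribEquiv k V E).injective
  exact hd.comp (TensorProduct.map_injective_of_flat_flat B T hB hT)

/-- A space with an injective skew-symmetric form in characteristic not two is
even-dimensional. -/
theorem LinearMap.BilinForm.even_finrank_of_skew {k U : Type*} [Field k] [NeZero (2 : k)]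
    [AddCommGroup U] [Module k U] [FiniteDimensional k U] (F : LinearMap.BilinForm k U)
    (hskew : ∀ x y, F x y = -F y x) (hF : Function.Injective F) :
    Even (Module.finrank k U) := by
  let b := Module.finBasis k U
  let A := BilinForm.toMatrix b F
  have hdet : A.det ≠ 0 := by
    have hnd : F.SeparatingLeft := by
      rw [separatingLeft_iff_ker_eq_bot, ker_eq_bot]; exact hF
    exact (separatingLeft_iff_det_ne_zero b).1 hnd
  have hA : A.transpose = -A := by
    ext i j
    simp only [A, Matrix.transpose_apply, Matrix.neg_apply, BilinForm.toMatrix_apply]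
    exact hskew _ _
  by_contra hodd
  rw [Nat.not_even_iff_odd] at hodd
  have h := A.det_transpose
  rw [hA, Matrix.det_neg, Fintype.card_fin, hodd.neg_one_pow, neg_one_mul, neg_eq_iff_add_eq_zero,
    ← two_mul] at h
  exact hdet ((mul_eq_zero.1 h).resolve_left two_ne_zero)

/-- The invariants of a representation of a finite group preserving a non-degenerate
skew-symmetric form are even-dimensional. -/
theorem Representation.even_finrank_invariants_of_skew {k G U : Type*} [Field k] [CharZero k]
    [Group G] [Fintype G] [AddCommGroup U] [Module k U] [FiniteDimensional k U]
    (τ : Representation k G U) (F : LinearMap.BilinForm k U)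
    (hinv : ∀ g x y, F (τ g x) (τ g y) = F x y)
    (hskew : ∀ x y, F x y = -F y x) (hF : Function.Injective F) :
    Even (Module.finrank k τ.invariants) := by
  refine LinearMap.BilinForm.even_finrank_of_skew (F.restrict τ.invariants)
    (fun x y => hskew x y) ?_
  rw [injective_iff_map_eq_zero]
  intro x hx
  have hsum : ∀ y, ∑ g : G, τ g y ∈ τ.invariants := by
    intro y h
    rw [map_sum]
    simp_rw [← Module.End.mul_apply, ← map_mul]
    exact Fintype.sum_bijective (h * ·) (Group.mulLeft_bijective h) _ _ fun _ => rfl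
  have key : F x = 0 := by
    ext y
    have h0 : F x (∑ g : G, τ g y) = 0 := LinearMap.congr_fun hx ⟨_, hsum y⟩
    have h1 : ∀ g, F x (τ g y) = F x y := fun g => by
      conv_lhs => rw [← x.2 g]
      exact hinv g x y
    simpa [map_sum, h1] using h0
  exact Subtype.ext (hF (key.trans (map_zero F).symm))

open scoped ComplexOrder Matrix in
/-- The character of a complex representation of a finite group at `g⁻¹` is the complex conjugate
of its value at `g`. -/
theorem Representation.conj_character {G W : Type*} [Group G] [Finite G] [AddCommGroup W]
    [Module ℂ W] [FiniteDimensional ℂ W] (σ : Representation ℂ G W) (g : G) :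
    (starRingEnd ℂ) (σ.character g) = σ.character g⁻¹ := by
  have := Fintype.ofFinite G
  let b := Module.finBasis ℂ W
  let M : G → Matrix _ _ ℂ := fun h => LinearMap.toMatrix b b (σ h)
  have hmul : ∀ g h, M (g * h) = M g * M h := fun g h => by
    simp only [M, map_mul, LinearMap.toMatrix_mul]
  have hone : M 1 = 1 := by simp only [M, map_one, LinearMap.toMatrix_one]
  have htr : ∀ h, σ.character h = (M h).trace := fun h =>
    LinearMap.trace_eq_matrix_trace ℂ b (σ h)
  let P := ∑ h : G, (M h)ᴴ * M h
  have hP : P.PosDef := by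
    classical
    simp only [P]
    rw [← Finset.add_sum_erase _ _ (Finset.mem_univ (1 : G)), hone, Matrix.conjTranspose_one,
      one_mul]
    exact Matrix.PosDef.one.add_posSemidef
      (Matrix.posSemidef_sum _ fun h _ => Matrix.posSemidef_conjTranspose_mul_self _)
  have hPg : (M g)ᴴ * P * M g = P := by
    simp only [P, Finset.mul_sum, Finset.sum_mul]
    refine Fintype.sum_bijective (· * g) (Group.mulRight_bijective g) _ _ fun h => ?_
    simp only [hmul, Matrix.conjTranspose_mul, mul_assoc]
  have hdet : IsUnit P.det := (Matrix.isUnit_iff_isUnit_det P).1 hP.isUnit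
  have hconj : (M g)ᴴ = P * M g⁻¹ * P⁻¹ := by
    have hgg : M g * M g⁻¹ = 1 := by rw [← hmul, mul_inv_cancel, hone]
    calc (M g)ᴴ = (M g)ᴴ * P * (M g * M g⁻¹) * P⁻¹ := by
          rw [hgg, mul_one, Matrix.mul_nonsing_inv_cancel_right _ _ hdet]
      _ = P * M g⁻¹ * P⁻¹ := by rw [← mul_assoc, hPg]
  rw [htr, htr, starRingEnd_apply, ← Matrix.trace_conjTranspose, hconj, Matrix.trace_mul_comm,
    Matrix.nonsing_inv_mul_cancel_left _ _ hdet]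

/-- If a finite-dimensional complex representation `ρ : G → GL(V)` preserves a
non-degenerate alternating bilinear form, then every diagonal entry `⟨χ_ρ · χᵢ, χᵢ⟩`
of the McKay matrix `A_ρ(G)` is even. -/
theorem mckay_diagonal_even_of_skew_form (G : Type) [Group G] [Fintype G]
    (V : Type) [AddCommGroup V] [Module ℂ V] [FiniteDimensional ℂ V]
    (ρ : Representation ℂ G V) (B : V →ₗ[ℂ] V →ₗ[ℂ] ℂ)
    (hinv : ∀ (g : G) (v w : V), B (ρ g v) (ρ g w) = B v w)
    (halt : ∀ v : V, B v v = 0)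
    (hnondeg : ∀ v : V, (∀ w : V, B v w = 0) → v = 0)
    (χi : G → ℂ) (hχi : IsIrrChar G χi) :
    ∃ m : ℕ, innChar G ((fun g => LinearMap.trace ℂ V (ρ g)) * χi) χi = (2 * m : ℂ) := by
  obtain ⟨W, -, rfl⟩ := hχi
  let σ : Representation ℂ G W := W.ρ
  let T := LinearMap.endTraceForm ℂ W
  let F := LinearMap.BilinForm.tensorToDual B T
  let τ := ρ.tprod (σ.linHom σ)
  have hBskew : ∀ v w, B v w = -B w v := fun v w => (LinearMap.IsAlt.neg halt w v).symm
  have hTinv : ∀ g a b, T (σ.linHom σ g a) (σ.linHom σ g b) = T a b := fun g a b => by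
    have h : (σ g ∘ₗ a ∘ₗ σ g⁻¹) ∘ₗ (σ g ∘ₗ b ∘ₗ σ g⁻¹) = σ g ∘ₗ ((a ∘ₗ b) ∘ₗ σ g⁻¹) := by
      ext w
      simp
    have h' : ((a ∘ₗ b) ∘ₗ σ g⁻¹) ∘ₗ σ g = a ∘ₗ b := by
      ext w
      simp
    simp only [T, LinearMap.endTraceForm_apply, Representation.linHom_apply]
    rw [h, LinearMap.trace_comp_comm', h']
  have hFinv : ∀ g x y, F (τ g x) (τ g y) = F x y := fun g x y => by
    induction x with
    | zero => simp
    | add x x' hx hx' => simp only [map_add, LinearMap.add_apply, hx, hx']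
    | tmul v a =>
      induction y with
      | zero => simp
      | add y y' hy hy' => simp only [map_add, hy, hy']
      | tmul w b =>
        simp only [F, τ, Representation.tprod_apply, TensorProduct.map_tmul,
          LinearMap.BilinForm.tensorToDual_tmul, hinv, hTinv]
  have hFskew : ∀ x y, F x y = -F y x := fun x y => by
    induction x with
    | zero => simp
    | add x x' hx hx' => simp only [map_add, LinearMap.add_apply, hx, hx', neg_add]
    | tmul v a =>
      induction y with
      | zero => simp
      | add y y' hy hy' => simp only [map_add, LinearMap.add_apply, hy, hy', neg_add]
      | tmul w b =>
        simp only [F, T, LinearMap.BilinForm.tensorToDual_tmul, LinearMap.endTraceForm_apply]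
        rw [hBskew v w, LinearMap.trace_comp_comm', neg_mul]
  have hB : Function.Injective B := (injective_iff_map_eq_zero B).2 fun v hv =>
    hnondeg v (LinearMap.congr_fun hv)
  have hF : Function.Injective F := LinearMap.BilinForm.tensorToDual_injective hB
    (LinearMap.endTraceForm_injective ℂ W)
  obtain ⟨m, hm⟩ := (τ.even_finrank_invariants_of_skew F hFinv hFskew hF).two_dvd
  have : Invertible (Nat.card G : ℂ) := invertibleOfNonzero (Nat.cast_ne_zero.2 Nat.card_pos.ne')
  refine ⟨m, ?_⟩
  have hchar : innChar G ((fun g => LinearMap.trace ℂ V (ρ g)) * W.character) W.character =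
      (Nat.card G : ℂ)⁻¹ * ∑ g : G, τ.character g := by
    rw [innChar, Nat.card_eq_fintype_card]
    congr 1
    refine Finset.sum_congr rfl fun g _ => ?_
    have hτ : τ.character g = ρ.character g * (σ.character g⁻¹ * σ.character g) := by
      rw [Representation.char_tensor, Pi.mul_apply, Representation.char_linHom]
    rw [hτ, ← σ.conj_character g]
    change ρ.character g * σ.character g * (starRingEnd ℂ) (σ.character g) = _
    ring
  rw [hchar, τ.card_inv_mul_sum_char_eq_finrank, hm]
  push_cast
  rfl
end

section
/- Let G be a finite group and ρ a faithful finite-dimensional complex representation of G. Suppose v : Irr(G) → ℕ is a vector with all entries positive whose entries have greatest common divisor 1, and suppose v is an eigenvector of the McKay matrix A_ρ(G) for some eigenvalue k (i.e., A_ρ(G)·v = k·v for some k). Then k = dim ρ and v(χ) = χ(1) for every irreducible character χ; that is, the unique reduced weight vector of the McKay quiver of a faithful representation is the dimension vector of the irreducible representations. -/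
open CategoryTheory Representation

open scoped ComplexOrder MatrixOrder MonoidAlgebra

namespace Matrix

variable {G n : Type*} [Group G] [Finite G] [Fintype n] [DecidableEq n]

/-- Every complex matrix representation of a finite group is conjugate to a unitary one. -/
theorem exists_conj_mem_unitaryGroup (M : G →* Matrix n n ℂ) :
    ∃ Q : (Matrix n n ℂ)ˣ, ∀ g, Q * M g * (Q⁻¹ : (Matrix n n ℂ)ˣ) ∈ unitaryGroup n ℂ := by
  have := Fintype.ofFinite G
  classical
  set P : Matrix n n ℂ := ∑ g, (M g)ᴴ * M g with hP
  have hPpos : P.PosDef := by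
    rw [hP, ← Finset.add_sum_erase _ _ (Finset.mem_univ (1 : G))]
    refine PosDef.add_posSemidef (by simpa using PosDef.one) ?_
    exact posSemidef_sum _ fun g _ => posSemidef_conjTranspose_mul_self _
  have hinv (g : G) : (M g)ᴴ * P * M g = P := by
    rw [hP, Finset.mul_sum, Finset.sum_mul]
    refine Fintype.sum_equiv (Equiv.mulRight g) _ _ fun h => ?_
    simp [conjTranspose_mul, mul_assoc]
  obtain ⟨Q, hQ⟩ := CStarAlgebra.nonneg_iff_eq_star_mul_self.mp hPpos.posSemidef.nonneg
  have hQu : IsUnit Q := isUnit_of_mul_isUnit_right (hQ ▸ hPpos.isUnit)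
  obtain ⟨Q, rfl⟩ := hQu
  refine ⟨Q, fun g => ?_⟩
  rw [mem_unitaryGroup_iff']
  have hQi : star (↑Q⁻¹ : Matrix n n ℂ) * star (Q : Matrix n n ℂ) = 1 := by
    rw [← star_mul, Units.mul_inv, star_one]
  calc star ((Q : Matrix n n ℂ) * M g * ↑Q⁻¹) * (Q * M g * ↑Q⁻¹)
      = star (↑Q⁻¹ : Matrix n n ℂ) * ((M g)ᴴ * (star (Q : Matrix n n ℂ) * Q) * M g) * ↑Q⁻¹ := by
        simp only [star_mul, star_eq_conjTranspose, mul_assoc]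
    _ = (star (↑Q⁻¹ : Matrix n n ℂ) * star (Q : Matrix n n ℂ)) * (Q * ↑Q⁻¹) := by
        rw [← hQ, hinv, hQ]; simp only [mul_assoc]
    _ = 1 := by rw [hQi, Units.mul_inv, one_mul]

theorem trace_map_inv_eq_star (M : G →* Matrix n n ℂ) (g : G) :
    (M g⁻¹).trace = star (M g).trace := by
  obtain ⟨Q, hQ⟩ := exists_conj_mem_unitaryGroup M
  have htr (h : G) : (Q * M h * (Q⁻¹ : (Matrix n n ℂ)ˣ)).trace = (M h).trace := by
    rw [trace_mul_cycle, Units.inv_mul, one_mul]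
  have hmul : (Q * M g * (Q⁻¹ : (Matrix n n ℂ)ˣ)) * (Q * M g⁻¹ * (Q⁻¹ : (Matrix n n ℂ)ˣ)) = 1 := by
    calc (Q * M g * (Q⁻¹ : (Matrix n n ℂ)ˣ)) * (Q * M g⁻¹ * (Q⁻¹ : (Matrix n n ℂ)ˣ))
        = Q * M g * (↑Q⁻¹ * Q) * M g⁻¹ * ↑Q⁻¹ := by simp only [mul_assoc]
      _ = Q * (M g * M g⁻¹) * ↑Q⁻¹ := by rw [Units.inv_mul, mul_one]; simp only [mul_assoc]
      _ = 1 := by rw [← map_mul, mul_inv_cancel, map_one, mul_one, Units.mul_inv]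
  rw [← htr, ← htr g, ← trace_conjTranspose,
    ← left_inv_eq_right_inv (mem_unitaryGroup_iff'.mp (hQ g)) hmul, star_eq_conjTranspose]

theorem eq_one_of_mem_unitaryGroup_of_trace_eq_card {U : Matrix n n ℂ}
    (hU : U ∈ unitaryGroup n ℂ) (htr : U.trace = Fintype.card n) : U = 1 := by
  rw [← sub_eq_zero, ← trace_conjTranspose_mul_self_eq_zero_iff]
  have hU' : Uᴴ * U = 1 := mem_unitaryGroup_iff'.mp hU
  rw [conjTranspose_sub, conjTranspose_one, sub_mul, mul_sub, mul_sub, hU']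
  simp [trace_sub, trace_conjTranspose, htr]

theorem map_eq_one_of_trace_eq_card (M : G →* Matrix n n ℂ) {g : G}
    (htr : (M g).trace = Fintype.card n) : M g = 1 := by
  obtain ⟨Q, hQ⟩ := exists_conj_mem_unitaryGroup M
  have h := eq_one_of_mem_unitaryGroup_of_trace_eq_card (hQ g)
    (by rw [trace_mul_cycle, Units.inv_mul, one_mul, htr])
  rw [Units.mul_inv_eq_iff_eq_mul, one_mul] at h
  exact Q.mul_right_inj.mp (h.trans (mul_one _).symm)

end Matrix

namespace Representation

section Complex

variable {G V : Type*} [Group G] [Finite G] [AddCommGroup V] [Module ℂ V] [FiniteDimensional ℂ V]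
  (ρ : Representation ℂ G V)

theorem char_inv_eq_star (g : G) : ρ.character g⁻¹ = star (ρ.character g) := by
  have h := Matrix.trace_map_inv_eq_star
    ((MonoidHomClass.toMonoidHom (LinearMap.toMatrixAlgEquiv (Module.finBasis ℂ V))).comp ρ) g
  simpa [character, LinearMap.trace_eq_matrix_trace ℂ (Module.finBasis ℂ V),
    LinearMap.toMatrixAlgEquiv, LinearMap.toMatrix] using h

theorem eq_one_of_char_eq_finrank {g : G} (h : ρ.character g = Module.finrank ℂ V) :
    ρ g = 1 := by
  have h := Matrix.map_eq_one_of_trace_eq_card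
    ((MonoidHomClass.toMonoidHom (LinearMap.toMatrixAlgEquiv (Module.finBasis ℂ V))).comp ρ) (g := g)
    (by
      rw [Fintype.card_fin, ← h, character, LinearMap.trace_eq_matrix_trace ℂ (Module.finBasis ℂ V)]
      rfl)
  exact (LinearMap.toMatrixAlgEquiv (Module.finBasis ℂ V)).injective (h.trans (map_one _).symm)

end Complex

section OfModule

variable {k G : Type*} [Field k] [Group G] (M : Type*) [AddCommGroup M] [Module k M]
  [Module k[G] M] [IsScalarTower k k[G] M]

theorem asAlgebraHom_ofModule'_apply (r : k[G]) (m : M) :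
    (ofModule' (k := k) (G := G) M).asAlgebraHom r m = r • m := by
  simp [ofModule', asAlgebraHom]

theorem isIrreducible_ofModule' [IsSimpleModule k[G] M] :
    IsIrreducible (ofModule' (k := k) (G := G) M) := by
  rw [irreducible_iff_isSimpleModule_asModule]
  let e : (ofModule' (k := k) (G := G) M).asModule ≃ₗ[k[G]] M :=
    { (ofModule' (k := k) (G := G) M).asModuleEquiv with
      map_smul' := fun r x => by
        simp [asAlgebraHom_ofModule'_apply] }
  exact IsSimpleModule.congr e

end OfModule

section ClassFunction

variable {k G : Type*} [Field k] [Group G] [Fintype G]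

theorem sum_single_mem_center {F : G → k} (hF : ∀ g h, F (h * g * h⁻¹) = F g) :
    ∑ g, MonoidAlgebra.single g (F g) ∈ Submonoid.center k[G] := by
  rw [Submonoid.mem_center_iff]
  intro x
  induction x using MonoidAlgebra.induction_on with
  | of h =>
    simp only [MonoidAlgebra.of_apply, Finset.mul_sum, Finset.sum_mul,
      MonoidAlgebra.single_mul_single, one_mul, mul_one]
    refine Fintype.sum_equiv (MulAut.conj h).toEquiv _ _ fun g => ?_
    simp [hF]
  | add x y hx hy => rw [add_mul, mul_add, hx, hy]
  | smul r x hx => rw [smul_mul_assoc, mul_smul_comm, hx]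

theorem asAlgebraHom_sum_single {V : Type*} [AddCommGroup V] [Module k V]
    (ρ : Representation k G V) (F : G → k) :
    ρ.asAlgebraHom (∑ g, MonoidAlgebra.single g (F g)) = ∑ g, F g • ρ g := by
  simp [asAlgebraHom_single]

variable [IsAlgClosed k] [CharZero k]

omit [Fintype G] in
/-- A central element of the group algebra whose trace on an irreducible representation vanishes
acts on it as zero. -/
theorem IsIrreducible.asAlgebraHom_eq_zero_of_mem_center {V : Type*} [AddCommGroup V] [Module k V]
    [FiniteDimensional k V] (ρ : Representation k G V) [IsIrreducible ρ] {z : k[G]}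
    (hz : z ∈ Submonoid.center k[G]) (htr : LinearMap.trace k V (ρ.asAlgebraHom z) = 0) :
    ρ.asAlgebraHom z = 0 := by
  obtain ⟨c, hc⟩ := IsIrreducible.algebraMap_intertwiningMap_bijective_of_isAlgClosed.surjective
    (IntertwiningMap.centralAlgebraMul ρ hz)
  have hc' : ρ.asAlgebraHom z = c • 1 := by
    ext x
    simpa using congr($hc.symm x)
  rw [hc', map_smul, LinearMap.trace_one, smul_eq_mul, mul_eq_zero] at htr
  rcases htr with h | h
  · rw [hc', h, zero_smul]
  · have := Module.finrank_zero_iff.mp (Nat.cast_eq_zero.mp h)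
    exact Subsingleton.elim _ _

end ClassFunction

end Representation

namespace FDRep

variable {k G : Type} [Field k] [IsAlgClosed k] [CharZero k] [Group G] [Fintype G]

theorem simple_of_isIrreducible_s16 {V : Type} [AddCommGroup V] [Module k V]
    [FiniteDimensional k V] (ρ : Representation k G V) [Representation.IsIrreducible ρ] :
    Simple (FDRep.of ρ) := by
  have : Invertible (Nat.card G : k) := invertibleOfNonzero (NeZero.ne _)
  have h := card_inv_mul_sum_char_mul_char_eq_finrank ρ ρ
  rw [IsIrreducible.finrank_intertwiningMap_self, Nat.cast_one,
    inv_mul_eq_one₀ (NeZero.ne _)] at h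
  exact (simple_iff_char_is_norm_one _).mpr h.symm

/-- A class function orthogonal to all irreducible characters vanishes. -/
theorem eq_zero_of_sum_mul_char_eq_zero {F : G → k} (hF : ∀ g h, F (h * g * h⁻¹) = F g)
    (h : ∀ V : FDRep k G, Simple V → ∑ g, F g * V.character g = 0) : F = 0 := by
  have hz := Representation.sum_single_mem_center hF
  set z : k[G] := ∑ g, MonoidAlgebra.single g (F g) with hz_def
  have hz0 : z = 0 := by
    rw [← Ideal.mem_bot, ← IsSemisimpleRing.jacobson_eq_bot k[G], Ring.jacobson_eq_sInf_isMaximal,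
      Ideal.mem_sInf]
    intro I (hI : I.IsMaximal)
    have : IsSimpleModule k[G] (k[G] ⧸ I) := isSimpleModule_iff_isCoatom.mpr hI.out
    have := isIrreducible_ofModule' (k := k) (G := G) (k[G] ⧸ I)
    have : Module.Finite k (k[G] ⧸ I) := Module.Finite.trans k[G] _
    have hact := IsIrreducible.asAlgebraHom_eq_zero_of_mem_center
      (ofModule' (k := k) (G := G) (k[G] ⧸ I)) hz (by
        rw [hz_def, asAlgebraHom_sum_single, map_sum]
        simpa using! h _ (simple_of_isIrreducible_s16 (ofModule' (k := k) (G := G) (k[G] ⧸ I))))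
    have h1 := congr($hact (Submodule.Quotient.mk 1))
    rw [asAlgebraHom_ofModule'_apply, LinearMap.zero_apply, ← Submodule.Quotient.mk_smul,
      Submodule.Quotient.mk_eq_zero] at h1
    simpa using h1
  ext g
  have := congr(($hz0).coeff g)
  classical
  simpa [hz_def, Finsupp.finsetSum_apply, Finsupp.single_apply] using this

end FDRep

namespace FDRep

variable {G : Type} [Group G] [Fintype G]

open scoped Classical in
theorem innChar_char_char (V W : FDRep ℂ G) [Simple V] [Simple W] :
    innChar G V.character W.character = if V.character = W.character then 1 else 0 := by
  have : Invertible (Nat.card G : ℂ) := invertibleOfNonzero (NeZero.ne _)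
  have hconj (g : G) : starRingEnd ℂ (W.character g) = W.character g⁻¹ :=
    (Representation.char_inv_eq_star W.ρ g).symm
  have h := char_orthonormal V W
  simp only [innChar, hconj, ← Nat.card_eq_fintype_card, h]
  by_cases hVW : Nonempty (V ≅ W)
  · simp [hVW, char_iso hVW.some]
  · rw [if_neg hVW, if_neg]
    intro he
    rw [if_neg hVW, ← he] at h
    simp [(simple_iff_char_is_norm_one V).mp inferInstance] at h

theorem isIrrChar_one : IsIrrChar G 1 := by
  let V : FDRep ℂ G := FDRep.of (1 : Representation ℂ G ℂ)
  have hV : V.character = 1 := by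
    ext g
    simp [V, FDRep.character]
  exact ⟨V, (simple_iff_char_is_norm_one V).mpr (by simp [hV]), hV⟩

end FDRep

/-- For a faithful representation `ρ`, the unique reduced weight vector of the McKay quiver
is the dimension vector: if `v` has positive integer entries with greatest common divisor
`1` and is an eigenvector of the McKay matrix `A_ρ(G)` for some eigenvalue `k`, then
`k = dim ρ` and `v(χ) = χ(1)` for every irreducible character `χ`. -/
theorem reduced_weight_vector_of_faithful (G : Type) [Group G] [Fintype G]
    (Irr : Finset (G → ℂ)) (hIrr : ∀ χ, χ ∈ Irr ↔ IsIrrChar G χ)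
    (ρ : FDRep ℂ G) (hfaithful : Function.Injective ρ.ρ)
    (v : ↑Irr → ℕ) (hpos : ∀ i, 0 < v i)
    (hgcd : Finset.univ.gcd v = 1)
    (k : ℂ)
    (hv : (Matrix.of fun i j : ↑Irr => innChar G (ρ.character * ↑i) ↑j).mulVec
        (fun i => (v i : ℂ)) = k • fun i => (v i : ℂ)) :
    k = (Module.finrank ℂ ρ : ℂ) ∧ ∀ i : ↑Irr, (v i : ℂ) = (↑i : G → ℂ) 1 := by
  classical
  set ψ : G → ℂ := fun g => ∑ j, (v j : ℂ) * starRingEnd ℂ ((j : G → ℂ) g) with hψ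
  have hchar (i : Irr) : IsIrrChar G i := (hIrr i).mp i.2
  have hsum (φ : G → ℂ) : ∑ j : Irr, innChar G φ j * (v j : ℂ) =
      (Fintype.card G : ℂ)⁻¹ * ∑ g, φ g * ψ g := by
    simp only [innChar, hψ, Finset.mul_sum, Finset.sum_mul]
    rw [Finset.sum_comm]
    refine Finset.sum_congr rfl fun g _ => Finset.sum_congr rfl fun j _ => ?_
    ring
  have hexp (i : Irr) : (Fintype.card G : ℂ)⁻¹ * ∑ g, (i : G → ℂ) g * ψ g = v i := by
    have horth (j : Irr) : innChar G i j = if i = j then 1 else 0 := by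
      obtain ⟨V, hV, hVi⟩ := hchar i
      obtain ⟨W, hW, hWj⟩ := hchar j
      rw [← hVi, ← hWj, FDRep.innChar_char_char]
      simp only [hVi, hWj, ← Subtype.ext_iff]
    simp [← hsum, horth]
  have hcard : (Fintype.card G : ℂ)⁻¹ ≠ 0 := inv_ne_zero (Nat.cast_ne_zero.mpr Fintype.card_ne_zero)
  have hψconj (g h : G) : ψ (h * g * h⁻¹) = ψ g := by
    refine Finset.sum_congr rfl fun j _ => ?_
    obtain ⟨V, -, hV⟩ := hchar j
    simp [← hV]
  have hF : (fun g => (ρ.character g - k) * ψ g) = 0 := by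
    refine FDRep.eq_zero_of_sum_mul_char_eq_zero (fun g h => by simp [hψconj]) fun V hV => ?_
    have hi := congrFun hv ⟨V.character, (hIrr _).mpr ⟨V, hV, rfl⟩⟩
    simp only [Matrix.mulVec, dotProduct, Matrix.of_apply, Pi.smul_apply, smul_eq_mul, hsum] at hi
    rw [← hexp, mul_left_comm, mul_right_inj' hcard] at hi
    rw [← sub_eq_zero, Finset.mul_sum, ← Finset.sum_sub_distrib] at hi
    rw [← hi]
    refine Finset.sum_congr rfl fun g _ => ?_
    simp only [Pi.mul_apply]
    ring
  choose d hd using fun i : Irr => show ∃ n : ℕ, (i : G → ℂ) 1 = n by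
    obtain ⟨V, -, hV⟩ := hchar i
    exact ⟨_, hV ▸ V.char_one⟩
  let one : Irr := ⟨1, (hIrr 1).mpr FDRep.isIrrChar_one⟩
  have hψ1 : ψ 1 ≠ 0 := by
    have hd1 : d one = 1 := by
      have : (1 : G → ℂ) 1 = d one := hd one
      rw [Pi.one_apply] at this
      exact_mod_cast this.symm
    have : ψ 1 = ((∑ j, v j * d j : ℕ) : ℂ) := by simp [hψ, hd]
    rw [this, Nat.cast_ne_zero, ← Nat.pos_iff_ne_zero]
    exact Finset.sum_pos' (fun _ _ => Nat.zero_le _)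
      ⟨one, Finset.mem_univ _, by simpa [hd1] using hpos one⟩
  have hk : k = (Module.finrank ℂ ρ : ℂ) := by
    have := congrFun hF 1
    simpa [hψ1, sub_eq_zero, eq_comm] using this
  refine ⟨hk, ?_⟩
  have hψg (g : G) (hg : g ≠ 1) : ψ g = 0 := by
    refine (mul_eq_zero.mp (congrFun hF g)).resolve_left fun h => hg (hfaithful ?_)
    rw [map_one]
    exact Representation.eq_one_of_char_eq_finrank ρ.ρ ((sub_eq_zero.mp h).trans hk)
  have hvi (i : Irr) : (v i : ℂ) = d i * ((Fintype.card G : ℂ)⁻¹ * ψ 1) := by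
    rw [← hexp, Fintype.sum_eq_single 1 fun g hg => by rw [hψg g hg, mul_zero], hd]
    ring
  have hc : (Fintype.card G : ℂ)⁻¹ * ψ 1 = v one := by
    rw [← hexp, Fintype.sum_eq_single 1 fun g hg => by rw [hψg g hg, mul_zero]]
    simp [one]
  have hdvd (i : Irr) : v i = d i * v one := by
    have := hvi i
    rw [hc] at this
    exact_mod_cast this
  have hone : v one = 1 := Nat.dvd_one.mp
    (hgcd ▸ Finset.dvd_gcd fun i _ => Dvd.intro_left _ (hdvd i).symm)
  intro i
  rw [hd, hdvd i, hone, mul_one]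
end

section
/- Let G₁ and G₂ be finite groups. There exist faithful finite-dimensional complex representations ρ₁ of G₁ and ρ₂ of G₂ together with a bijection e : Irr(G₁) → Irr(G₂) satisfying ⟨χ_{ρ₁} · χ, χ'⟩ = ⟨χ_{ρ₂} · e(χ), e(χ')⟩ for all irreducible characters χ, χ' of G₁ (i.e., the McKay quivers Γ_{ρ₁}(G₁) and Γ_{ρ₂}(G₂) are isomorphic) if and only if there exists a bijection f : Irr(G₁) → Irr(G₂) with χ(1) = (f(χ))(1) for all χ ∈ Irr(G₁) (i.e., the irreducible representations of G₁ and G₂ have the same dimensions counted with multiplicity). -/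
open Module

/-- An endomorphism of finite order of a complex vector space is diagonalizable, with eigenvalues
of absolute value one. -/
theorem exists_basis_eigenvectors_of_pow_eq_one {V : Type} [AddCommGroup V] [Module ℂ V]
    [FiniteDimensional ℂ V] (f : End ℂ V) {n : ℕ} (hn : n ≠ 0) (hf : f ^ n = 1) :
    ∃ (ι : Type) (_ : Fintype ι) (b : Basis ι ℂ V) (μ : ι → ℂ),
      ∀ i, ‖μ i‖ = 1 ∧ f (b i) = μ i • b i := by
  have hss : f.IsSemisimple := by
    refine End.isSemisimple_of_squarefree_aeval_eq_zero
      (p := Polynomial.X ^ n - Polynomial.C 1) ?_ (by simp [hf])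
    exact (Polynomial.separable_X_pow_sub_C (1 : ℂ) (by exact_mod_cast hn) one_ne_zero).squarefree
  have hspan : ⊤ ≤ Submodule.span ℂ {v : V | ∃ μ : ℂ, f v = μ • v} := by
    rw [← hss.iSup_eigenspace_eq_top]
    exact iSup_le fun μ v hv => Submodule.subset_span ⟨μ, End.mem_eigenspace_iff.mp hv⟩
  have hmem : ∀ i, ∃ μ : ℂ, f (Basis.ofSpan hspan i) = μ • Basis.ofSpan hspan i := fun i =>
    Basis.ofSpan_subset hspan ⟨i, rfl⟩
  choose μ hμ using hmem
  refine ⟨_, FiniteDimensional.fintypeBasisIndex (Basis.ofSpan hspan), Basis.ofSpan hspan, μ,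
    fun i => ⟨?_, hμ i⟩⟩
  have hpow : ∀ m : ℕ, (f ^ m) (Basis.ofSpan hspan i) = μ i ^ m • Basis.ofSpan hspan i := by
    intro m
    induction m with
    | zero => simp
    | succ m ih => rw [pow_succ', End.mul_apply, ih, map_smul, hμ, smul_smul, ← pow_succ]
  have h := hpow n
  rw [hf, End.one_apply] at h
  refine Complex.norm_eq_one_of_pow_eq_one (n := n) ?_ hn
  exact smul_left_injective ℂ ((Basis.ofSpan hspan).ne_zero i) (by simpa using h.symm)

theorem trace_eq_sum_of_apply_basis {V ι : Type} [AddCommGroup V] [Module ℂ V] [Fintype ι]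
    (b : Basis ι ℂ V) {f : End ℂ V} {μ : ι → ℂ} (h : ∀ i, f (b i) = μ i • b i) :
    LinearMap.trace ℂ V f = ∑ i, μ i := by
  classical
  rw [LinearMap.trace_eq_matrix_trace ℂ b, Matrix.trace]
  simp [LinearMap.toMatrix_apply, h]

namespace Representation

theorem character_subrepresentation_add {G V : Type} [Group G] [AddCommGroup V] [Module ℂ V]
    [FiniteDimensional ℂ V] (ρ : Representation ℂ G V) {W W' : Subrepresentation ρ}
    (h : IsCompl W W') :
    W.toRepresentation.character + W'.toRepresentation.character = ρ.character := by
  have hc : IsCompl W.toSubmodule W'.toSubmodule := by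
    refine ⟨disjoint_iff.mpr ?_, codisjoint_iff.mpr ?_⟩
    · rw [← Subrepresentation.toSubmodule_inf, h.inf_eq_bot]; rfl
    · rw [← Subrepresentation.toSubmodule_sup, h.sup_eq_top]; rfl
  ext g
  let e := Submodule.prodEquivOfIsCompl _ _ hc
  have he : ρ g = e.conj ((W.toRepresentation g).prodMap (W'.toRepresentation g)) := by
    refine LinearMap.ext fun v => ?_
    obtain ⟨p, rfl⟩ := e.surjective v
    rw [LinearEquiv.conj_apply_apply, e.symm_apply_apply, Submodule.coe_prodEquivOfIsCompl',
      Submodule.coe_prodEquivOfIsCompl', map_add]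
    rfl
  rw [Pi.add_apply, character, character, character, he, LinearMap.trace_conj',
    LinearMap.trace_prodMap']

variable {G V : Type} [Group G] [Finite G] [AddCommGroup V] [Module ℂ V] [FiniteDimensional ℂ V]
  (ρ : Representation ℂ G V)

theorem exists_basis_eigenvectors (g : G) :
    ∃ (ι : Type) (_ : Fintype ι) (b : Basis ι ℂ V) (μ : ι → ℂ),
      ∀ i, ‖μ i‖ = 1 ∧ ρ g (b i) = μ i • b i :=
  exists_basis_eigenvectors_of_pow_eq_one (ρ g) (orderOf_pos g).ne'
    (by rw [← map_pow, pow_orderOf_eq_one, map_one])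

theorem character_inv (g : G) : ρ.character g⁻¹ = starRingEnd ℂ (ρ.character g) := by
  obtain ⟨ι, _, b, μ, h⟩ := ρ.exists_basis_eigenvectors g
  have hinv : ∀ i, ρ g⁻¹ (b i) = starRingEnd ℂ (μ i) • b i := by
    intro i
    have h0 : μ i ≠ 0 := norm_ne_zero_iff.mp (by simp [(h i).1])
    rw [← Complex.inv_eq_conj (h i).1, eq_inv_smul_iff₀ h0, ← map_smul, ← (h i).2,
      inv_self_apply]
  rw [character, character, trace_eq_sum_of_apply_basis b fun i => (h i).2,
    trace_eq_sum_of_apply_basis b hinv, map_sum]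

theorem eq_one_of_character_eq_finrank {g : G} (hg : ρ.character g = finrank ℂ V) : ρ g = 1 := by
  obtain ⟨ι, _, b, μ, h⟩ := ρ.exists_basis_eigenvectors g
  rw [character, trace_eq_sum_of_apply_basis b fun i => (h i).2, finrank_eq_card_basis b] at hg
  have hre : ∀ i, (μ i).re ≤ 1 := fun i => (h i).1 ▸ Complex.re_le_norm (μ i)
  have hsum : ∑ i, (μ i).re = ∑ _i : ι, (1 : ℝ) := by
    simpa using congrArg Complex.re hg
  have hone := (Finset.sum_eq_sum_iff_of_le fun i _ => hre i).mp hsum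
  refine b.ext fun i => ?_
  have hi : (μ i).re = 1 := hone i (Finset.mem_univ i)
  have : μ i = 1 := by
    have hn := Complex.sq_norm (μ i)
    rw [(h i).1, Complex.normSq_apply, hi] at hn
    apply Complex.ext
    · simpa using hi
    · simpa using (by nlinarith : (μ i).im * (μ i).im = 0)
  rw [(h i).2, this, one_smul, End.one_apply]

theorem isIrrChar_character [ρ.IsIrreducible] : IsIrrChar G ρ.character := by
  have := Fintype.ofFinite G
  have := invertibleOfNonzero (NeZero.ne (Nat.card G : ℂ))
  refine ⟨FDRep.of ρ, ?_, rfl⟩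
  rw [FDRep.simple_iff_char_is_norm_one]
  have h := char_orthonormal ρ ρ
  rw [if_pos ⟨Equiv.refl ρ⟩, inv_mul_eq_one₀ (NeZero.ne _)] at h
  exact h.symm

/-- By complete reducibility, every character is a linear combination of irreducible ones. -/
theorem character_mem_span_isIrrChar : ρ.character ∈ Submodule.span ℂ {χ | IsIrrChar G χ} := by
  induction hd : finrank ℂ V using Nat.strong_induction_on generalizing V with
  | _ d ih =>
  by_cases hirr : ρ.IsIrreducible
  · exact Submodule.subset_span ρ.isIrrChar_character
  rcases subsingleton_or_nontrivial V with hV | hV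
  · have : ρ.character = 0 := by
      ext g
      rw [character, Subsingleton.elim (ρ g) 0, map_zero, Pi.zero_apply]
    exact this ▸ Submodule.zero_mem _
  have hnt : Nontrivial (Subrepresentation ρ) :=
    ⟨⊥, ⊤, fun h => bot_ne_top (congrArg Subrepresentation.toSubmodule h)⟩
  obtain ⟨W, hW⟩ : ∃ W : Subrepresentation ρ, ¬ (W = ⊥ ∨ W = ⊤) := by
    by_contra! h
    exact hirr ⟨h⟩
  rw [not_or] at hW
  obtain ⟨W', hW'⟩ := exists_isCompl W
  have hlt : ∀ U : Subrepresentation ρ, U ≠ ⊤ → finrank ℂ U.toSubmodule < d := fun U hU =>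
    hd ▸ Submodule.finrank_lt fun h => hU (Subrepresentation.toSubmodule_injective h)
  rw [← ρ.character_subrepresentation_add hW']
  refine Submodule.add_mem _ (ih _ (hlt W hW.2) _ rfl) (ih _ (hlt W' ?_) _ rfl)
  rintro rfl
  exact hW.1 (eq_bot_of_isCompl_top hW')

end Representation

theorem IsIrrChar.exists_natCast_eq {G : Type} [Group G] {χ : G → ℂ} (h : IsIrrChar G χ) :
    ∃ n : ℕ, 0 < n ∧ χ 1 = n := by
  obtain ⟨V, hV, rfl⟩ := h
  refine ⟨_, ?_, V.char_one⟩
  rw [Module.finrank_pos_iff_exists_ne_zero]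
  by_contra! h0
  refine CategoryTheory.Simple.not_isZero V ?_
  rw [CategoryTheory.Limits.IsZero.iff_id_eq_zero]
  ext x
  rw [h0 x]
  simp

section IrreducibleCharacters

variable {G : Type} [Group G] [Fintype G] {Irr : Finset (G → ℂ)}

theorem innChar_add_left (φ φ' ψ : G → ℂ) :
    innChar G (φ + φ') ψ = innChar G φ ψ + innChar G φ' ψ := by
  simp [innChar, add_mul, mul_add, Finset.sum_add_distrib]

theorem innChar_smul_left (c : ℂ) (φ ψ : G → ℂ) : innChar G (c • φ) ψ = c * innChar G φ ψ := by
  simp only [innChar, Pi.smul_apply, smul_eq_mul, mul_assoc, ← Finset.mul_sum]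
  ring

theorem innChar_sum_left {ι : Type*} (s : Finset ι) (φ : ι → G → ℂ) (ψ : G → ℂ) :
    innChar G (∑ i ∈ s, φ i) ψ = ∑ i ∈ s, innChar G (φ i) ψ := by
  simp only [innChar, Finset.sum_apply, Finset.sum_mul, ← Finset.mul_sum]
  rw [Finset.sum_comm]

theorem conj_innChar (φ ψ : G → ℂ) : starRingEnd ℂ (innChar G φ ψ) = innChar G ψ φ := by
  simp [innChar, mul_comm]

theorem innChar_mul_left (ρ φ ψ : G → ℂ) :
    innChar G (ρ * φ) ψ = innChar G φ (star ρ * ψ) := by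
  simp only [innChar, Pi.mul_apply, Pi.star_apply, map_mul, starRingEnd_apply, star_star]
  congr 1
  exact Finset.sum_congr rfl fun g _ => by ring

theorem innChar_eq_of_support {φ : G → ℂ} (hφ : ∀ g, g ≠ 1 → φ g = 0) (ψ : G → ℂ) :
    innChar G φ ψ = (Fintype.card G : ℂ)⁻¹ * (φ 1 * starRingEnd ℂ (ψ 1)) := by
  rw [innChar, Finset.sum_eq_single 1 (fun g _ hg => by rw [hφ g hg, zero_mul]) (by simp)]

namespace FDRep

theorem character_inv (V : FDRep ℂ G) (g : G) :
    V.character g⁻¹ = starRingEnd ℂ (V.character g) :=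
  Representation.character_inv V.ρ g

theorem character_mem_span_isIrrChar (V : FDRep ℂ G) :
    V.character ∈ Submodule.span ℂ {χ | IsIrrChar G χ} :=
  Representation.character_mem_span_isIrrChar V.ρ

theorem star_character (V : FDRep ℂ G) :
    star V.character = (FDRep.of (Representation.dual V.ρ)).character := by
  ext g
  rw [char_dual, character_inv]
  rfl

theorem innChar_character (V W : FDRep ℂ G) :
    innChar G V.character W.character = (Module.finrank ℂ (W ⟶ V) : ℂ) := by
  have := invertibleOfNonzero (NeZero.ne (Nat.card G : ℂ))
  rw [← scalar_product_char_eq_finrank_equivariant]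
  simp only [innChar, character_inv, Nat.card_eq_fintype_card]

end FDRep

open Classical in
theorem IsIrrChar.innChar_eq {χ χ' : G → ℂ} (h : IsIrrChar G χ) (h' : IsIrrChar G χ') :
    innChar G χ χ' = if χ = χ' then 1 else 0 := by
  obtain ⟨V, hV, rfl⟩ := h
  obtain ⟨W, hW, rfl⟩ := h'
  rw [FDRep.innChar_character]
  split_ifs with h
  · rw [← FDRep.innChar_character, ← h, FDRep.innChar_character,
      CategoryTheory.finrank_endomorphism_simple_eq_one, Nat.cast_one]
  · rw [FDRep.finrank_hom_simple_simple, if_neg, Nat.cast_zero]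
    rintro ⟨i⟩
    exact h (FDRep.char_iso i).symm

theorem sum_innChar_smul_of_mem_span (hIrr : ∀ χ, χ ∈ Irr ↔ IsIrrChar G χ) {φ : G → ℂ}
    (hφ : φ ∈ Submodule.span ℂ {χ | IsIrrChar G χ}) :
    ∑ χ : Irr, innChar G φ χ • (χ : G → ℂ) = φ := by
  classical
  induction hφ using Submodule.span_induction with
  | mem φ h =>
    have hφ : φ ∈ Irr := (hIrr φ).mpr h
    rw [Finset.sum_eq_single (⟨φ, hφ⟩ : Irr)]
    · rw [IsIrrChar.innChar_eq h h, if_pos rfl, one_smul]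
    · intro χ _ hχ
      rw [IsIrrChar.innChar_eq h ((hIrr _).mp χ.2), if_neg (fun e => hχ (Subtype.ext e.symm)),
        zero_smul]
    · simp
  | zero => simp [innChar]
  | add φ ψ _ _ hφ hψ => simp only [innChar_add_left, add_smul, Finset.sum_add_distrib, hφ, hψ]
  | smul c φ _ hφ => simp only [innChar_smul_left, mul_smul, ← Finset.smul_sum, hφ]

theorem isIrrChar_one_s18 : IsIrrChar G 1 := by
  have : (FDRep.of (Representation.trivial ℂ G ℂ)).character = 1 := by
    ext g
    simp [FDRep.character]
  refine ⟨FDRep.of (Representation.trivial ℂ G ℂ), ?_, this⟩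
  rw [FDRep.simple_iff_char_is_norm_one, this]
  simp

theorem sum_innChar_character_mul_mul_apply (hIrr : ∀ χ, χ ∈ Irr ↔ IsIrrChar G χ)
    (ρ : FDRep ℂ G) (χ : Irr) (g : G) :
    ∑ χ' : Irr, innChar G (ρ.character * ↑χ) ↑χ' * (χ' : G → ℂ) g
      = ρ.character g * (χ : G → ℂ) g := by
  obtain ⟨V, -, hV⟩ := (hIrr χ).mp χ.2
  have h := sum_innChar_smul_of_mem_span hIrr
    (FDRep.character_mem_span_isIrrChar (CategoryTheory.MonoidalCategoryStruct.tensorObj ρ V))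
  rw [FDRep.char_tensor, hV] at h
  simpa using congrFun h g

theorem innChar_character_mul_eq (hIrr : ∀ χ, χ ∈ Irr ↔ IsIrrChar G χ) (ρ : FDRep ℂ G)
    (χ χ' : Irr) :
    innChar G (ρ.character * ↑χ) ↑χ' =
      innChar G ((FDRep.of (Representation.dual ρ.ρ)).character * ↑χ') ↑χ := by
  obtain ⟨V, -, hV⟩ := (hIrr χ).mp χ.2
  obtain ⟨W, -, hW⟩ := (hIrr χ').mp χ'.2
  rw [← FDRep.star_character, ← conj_innChar (χ : G → ℂ), ← innChar_mul_left, ← hV, ← hW,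
    ← FDRep.char_tensor, FDRep.innChar_character, map_natCast]

theorem sum_innChar_character_mul_mul_apply' (hIrr : ∀ χ, χ ∈ Irr ↔ IsIrrChar G χ)
    (ρ : FDRep ℂ G) (χ' : Irr) (g : G) :
    ∑ χ : Irr, innChar G (ρ.character * ↑χ) ↑χ' * (χ : G → ℂ) g
      = starRingEnd ℂ (ρ.character g) * (χ' : G → ℂ) g := by
  simp only [innChar_character_mul_eq hIrr ρ]
  rw [sum_innChar_character_mul_mul_apply hIrr, ← FDRep.star_character]
  rfl

/-- If `ρ` is faithful, the eigenspace of its McKay matrix for the eigenvalue `dim ρ` is spanned by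
the vector of dimensions of the irreducible representations. -/
theorem exists_forall_eq_mul_of_eigenvector (hIrr : ∀ χ, χ ∈ Irr ↔ IsIrrChar G χ)
    (ρ : FDRep ℂ G) (hρ : Function.Injective ρ.ρ) (w : Irr → ℂ)
    (hw : ∀ χ : Irr, ∑ χ' : Irr, innChar G (ρ.character * ↑χ) ↑χ' * w χ'
      = ρ.character 1 * w χ) :
    ∃ c : ℂ, ∀ χ : Irr, w χ = c * (χ : G → ℂ) 1 := by
  classical
  set F : G → ℂ := ∑ χ : Irr, w χ • (χ : G → ℂ) with hF
  have hFg : ∀ g, F g = ∑ χ : Irr, w χ * (χ : G → ℂ) g := fun g => by simp [hF]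
  have hmul : ∀ g, starRingEnd ℂ (ρ.character g) * F g = ρ.character 1 * F g := by
    intro g
    calc starRingEnd ℂ (ρ.character g) * F g
        = ∑ χ' : Irr, w χ' * (starRingEnd ℂ (ρ.character g) * (χ' : G → ℂ) g) := by
          rw [hFg, Finset.mul_sum]
          exact Finset.sum_congr rfl fun _ _ => by ring
      _ = ∑ χ : Irr, (∑ χ' : Irr, innChar G (ρ.character * ↑χ) ↑χ' * w χ') * (χ : G → ℂ) g := by
          simp only [← sum_innChar_character_mul_mul_apply' hIrr, Finset.mul_sum, Finset.sum_mul]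
          rw [Finset.sum_comm]
          exact Finset.sum_congr rfl fun _ _ => Finset.sum_congr rfl fun _ _ => by ring
      _ = ρ.character 1 * F g := by
          simp only [hw, hFg, Finset.mul_sum, mul_assoc]
  have hsupp : ∀ g, g ≠ 1 → F g = 0 := by
    intro g hg
    by_contra h
    have h1 := congrArg (starRingEnd ℂ) (mul_right_cancel₀ h (hmul g))
    rw [starRingEnd_self_apply, FDRep.char_one, map_natCast] at h1
    exact hg (hρ ((Representation.eq_one_of_character_eq_finrank ρ.ρ h1).trans
      (map_one ρ.ρ).symm))
  refine ⟨(Fintype.card G : ℂ)⁻¹ * F 1, fun χ => ?_⟩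
  have h1 : innChar G F χ = w χ := by
    rw [hF, innChar_sum_left, Finset.sum_eq_single χ]
    · have h := (hIrr χ).mp χ.2
      rw [innChar_smul_left, h.innChar_eq h, if_pos rfl, mul_one]
    · intro χ' _ hχ
      rw [innChar_smul_left, ((hIrr _).mp χ'.2).innChar_eq ((hIrr _).mp χ.2),
        if_neg (fun e => hχ (Subtype.ext e)), mul_zero]
    · simp
  obtain ⟨n, -, hn⟩ := ((hIrr χ).mp χ.2).exists_natCast_eq
  rw [← h1, innChar_eq_of_support hsupp, hn, map_natCast, mul_assoc]

theorem exists_injective_character_support_one :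
    ∃ ρ : FDRep ℂ G, Function.Injective ρ.ρ ∧ ρ.character 1 = Fintype.card G ∧
      ∀ g, g ≠ 1 → ρ.character g = 0 := by
  classical
  refine ⟨TannakaDuality.FiniteGroup.rightFDRep, ?_, ?_, ?_⟩
  · intro s t h
    have h1 := congrFun (LinearMap.congr_fun h (Pi.single t (1 : ℂ))) 1
    change (Pi.single t 1 : G → ℂ) (1 * s) = (Pi.single t 1 : G → ℂ) (1 * t) at h1
    simpa [Pi.single_apply] using h1
  · rw [FDRep.char_one]
    exact congrArg _ (Module.finrank_fintype_fun_eq_card ℂ)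
  · intro g hg
    change LinearMap.trace ℂ (G → ℂ) (TannakaDuality.FiniteGroup.rightRegular g) = 0
    rw [LinearMap.trace_eq_matrix_trace ℂ (Pi.basisFun ℂ G), Matrix.trace]
    refine Finset.sum_eq_zero fun x _ => ?_
    simp [hg]

end IrreducibleCharacters

/-- Two finite groups `G₁` and `G₂` admit faithful representations `ρ₁`, `ρ₂` with
isomorphic McKay quivers `Γ_{ρ₁}(G₁) ≅ Γ_{ρ₂}(G₂)` (a bijection of vertex sets preserving
the McKay matrix entries) if and only if the irreducible representations of `G₁` and `G₂`
have the same dimensions counted with multiplicity (a bijection `Irr(G₁) → Irr(G₂)`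
preserving dimensions). -/
theorem isographical_groups_iff (G₁ G₂ : Type)
    [Group G₁] [Fintype G₁] [Group G₂] [Fintype G₂]
    (Irr₁ : Finset (G₁ → ℂ)) (hIrr₁ : ∀ χ, χ ∈ Irr₁ ↔ IsIrrChar G₁ χ)
    (Irr₂ : Finset (G₂ → ℂ)) (hIrr₂ : ∀ χ, χ ∈ Irr₂ ↔ IsIrrChar G₂ χ) :
    (∃ (ρ₁ : FDRep ℂ G₁) (ρ₂ : FDRep ℂ G₂),
      Function.Injective ρ₁.ρ ∧ Function.Injective ρ₂.ρ ∧
      ∃ e : ↑Irr₁ → ↑Irr₂, Function.Bijective e ∧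
        ∀ χ χ' : ↑Irr₁,
          innChar G₁ (ρ₁.character * ↑χ) ↑χ'
            = innChar G₂ (ρ₂.character * ↑(e χ)) ↑(e χ')) ↔
    (∃ f : ↑Irr₁ → ↑Irr₂, Function.Bijective f ∧
      ∀ χ : ↑Irr₁, (↑χ : G₁ → ℂ) 1 = (↑(f χ) : G₂ → ℂ) 1) := by
  classical
  constructor
  · rintro ⟨ρ₁, ρ₂, hρ₁, -, e, he, hA⟩
    set E := Equiv.ofBijective e he
    have hpos₁ := fun χ : Irr₁ => ((hIrr₁ χ).mp χ.2).exists_natCast_eq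
    have hpos₂ := fun χ : Irr₁ => ((hIrr₂ (e χ)).mp (e χ).2).exists_natCast_eq
    choose n hn0 hn using hpos₁
    choose m hm0 hm using hpos₂
    have hw : ∀ χ : Irr₁, ∑ χ' : Irr₁, innChar G₁ (ρ₁.character * ↑χ) ↑χ' * (m χ' : ℂ)
        = ρ₂.character 1 * m χ := by
      intro χ
      have h := sum_innChar_character_mul_mul_apply hIrr₂ ρ₂ (e χ) 1
      rw [← hm χ, ← h, ← E.sum_comp]
      exact Finset.sum_congr rfl fun χ' _ => by rw [hA, ← hm χ']; rfl
    have hsum : ∑ χ : Irr₁, (n χ : ℂ) * m χ ≠ 0 := by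
      have hone : (1 : G₁ → ℂ) ∈ Irr₁ := (hIrr₁ 1).mpr isIrrChar_one_s18
      exact_mod_cast (Finset.sum_pos (fun χ _ => Nat.mul_pos (hn0 χ) (hm0 χ))
        ⟨⟨1, hone⟩, Finset.mem_univ _⟩).ne'
    have hdim : ρ₂.character 1 = ρ₁.character 1 := by
      apply mul_right_cancel₀ hsum
      calc ρ₂.character 1 * ∑ χ : Irr₁, (n χ : ℂ) * m χ
          = ∑ χ : Irr₁, n χ * ∑ χ' : Irr₁, innChar G₁ (ρ₁.character * ↑χ) ↑χ' * (m χ' : ℂ) := by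
            simp only [hw, Finset.mul_sum]
            exact Finset.sum_congr rfl fun _ _ => by ring
        _ = ∑ χ' : Irr₁, m χ' *
              ∑ χ : Irr₁, innChar G₁ (ρ₁.character * ↑χ) ↑χ' * (χ : G₁ → ℂ) 1 := by
            simp only [hn, Finset.mul_sum]
            rw [Finset.sum_comm]
            exact Finset.sum_congr rfl fun _ _ => Finset.sum_congr rfl fun _ _ => by ring
        _ = ρ₁.character 1 * ∑ χ : Irr₁, (n χ : ℂ) * m χ := by
            simp only [sum_innChar_character_mul_mul_apply' hIrr₁]
            simp only [hn, FDRep.char_one, map_natCast, Finset.mul_sum]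
            exact Finset.sum_congr rfl fun _ _ => by ring
    obtain ⟨c, hc⟩ := exists_forall_eq_mul_of_eigenvector hIrr₁ ρ₁ hρ₁ (fun χ => (m χ : ℂ))
      (fun χ => by rw [hw, hdim])
    have hc_nat : c = m ⟨1, (hIrr₁ 1).mpr isIrrChar_one_s18⟩ := by simp [hc]
    obtain ⟨χ₀, hχ₀⟩ := he.2 ⟨1, (hIrr₂ 1).mpr isIrrChar_one_s18⟩
    have hc_one : c = 1 := by
      have h := hc χ₀
      rw [← hm χ₀, hχ₀, hn χ₀, hc_nat] at h
      change (1 : ℂ) = _ at h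
      norm_cast at h
      rw [hc_nat, Nat.eq_one_of_mul_eq_one_right h.symm, Nat.cast_one]
    exact ⟨e, he, fun χ => by rw [hm χ, hc, hc_one, one_mul]⟩
  · rintro ⟨f, hf, hdim⟩
    obtain ⟨ρ₁, hρ₁, hρ₁_one, hρ₁_supp⟩ := exists_injective_character_support_one (G := G₁)
    obtain ⟨ρ₂, hρ₂, hρ₂_one, hρ₂_supp⟩ := exists_injective_character_support_one (G := G₂)
    refine ⟨ρ₁, ρ₂, hρ₁, hρ₂, f, hf, fun χ χ' => ?_⟩
    rw [innChar_eq_of_support (fun g hg => by rw [Pi.mul_apply, hρ₁_supp g hg, zero_mul]),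
      innChar_eq_of_support (fun g hg => by rw [Pi.mul_apply, hρ₂_supp g hg, zero_mul]),
      Pi.mul_apply, Pi.mul_apply, hρ₁_one, hρ₂_one, hdim, hdim]
    have h₁ : (Fintype.card G₁ : ℂ) ≠ 0 := Nat.cast_ne_zero.mpr Fintype.card_ne_zero
    have h₂ : (Fintype.card G₂ : ℂ) ≠ 0 := Nat.cast_ne_zero.mpr Fintype.card_ne_zero
    field_simp
end
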